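/- Let n ≥ 3 be an integer, m = (n−2)/(n+2), β > 0, and γ = 2β/(1−m) (steady case ρ = 0). Then for every λ > 0 there exists a positive smooth radially symmetric function u on ℝⁿ with u(0) = λ solving ((n−1)/m)·Δ(u^m) + β·(x·∇u) + γ·u = 0 on all of ℝⁿ, and there exist constants 0 < c ≤ C and r₀ > 1 such that c·( log|x| / |x|² )^{1/(1−m)} ≤ u(x) ≤ C·( log|x| / |x|² )^{1/(1−m)} for all |x| ≥ r₀ (the logarithmic cigar solutions). -/

import Mathlib

open Real MeasureTheory Metric
open scoped Topology RealInnerProductSpace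

noncomputable section

/-- Euclidean space ℝⁿ. -/
abbrev Euc (n : ℕ) := EuclideanSpace ℝ (Fin n)

/-- Euclidean Laplacian: sum of pure second derivatives in the coordinate directions. -/
def lap {n : ℕ} (f : Euc n → ℝ) (x : Euc n) : ℝ :=
  ∑ i : Fin n, fderiv ℝ (fun y => fderiv ℝ f y (EuclideanSpace.single i 1)) x
    (EuclideanSpace.single i 1)

/-- The conformally flat Yamabe soliton equation
`((n-1)/m)·Δ(u^m) + β·(x·∇u) + γ·u = 0` on ℝⁿ. -/
def YamabePDE {n : ℕ} (m β γ : ℝ) (u : Euc n → ℝ) : Prop :=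
  ∀ x : Euc n, ((n : ℝ) - 1) / m * lap (fun y => u y ^ m) x
      + β * ⟪x, gradient u x⟫ + γ * u x = 0

/-- A function on ℝⁿ is radially symmetric if it depends only on the norm. -/
def IsRadial {n : ℕ} (u : Euc n → ℝ) : Prop :=
  ∀ x y : Euc n, ‖x‖ = ‖y‖ → u x = u y

/-- Scalar curvature of the conformally flat metric g = u^{4/(n+2)}·dx²:
`R = -(4(n-1)/(n-2))·u⁻¹·Δ(u^m)`. -/
def scalarCurv {n : ℕ} (m : ℝ) (u : Euc n → ℝ) (x : Euc n) : ℝ :=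
  -(4 * ((n : ℝ) - 1) / ((n : ℝ) - 2)) * lap (fun y => u y ^ m) x / u x

open Set Filter
open scoped NNReal BoundedContinuousFunction ContDiff

/-- The weighted average `∫₀¹ σ ^ j * f (σ² s) dσ` of `f` over the segment from `0` to `s`. -/
def kernelAvg (j : ℕ) (f : ℝ → ℝ) (s : ℝ) : ℝ :=
  ∫ σ in (0 : ℝ)..1, σ ^ j * f (σ ^ 2 * s)

lemma continuous_kernelAvg (j : ℕ) {f : ℝ → ℝ} (hf : Continuous f) :
    Continuous (kernelAvg j f) := by
  unfold kernelAvg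
  apply intervalIntegral.continuous_parametric_intervalIntegral_of_continuous'
  fun_prop

lemma abs_kernelAvg_le (j : ℕ) {f : ℝ → ℝ} {s B : ℝ}
    (h : ∀ σ ∈ Ioc (0 : ℝ) 1, |f (σ ^ 2 * s)| ≤ B) : |kernelAvg j f s| ≤ B := by
  have := intervalIntegral.norm_integral_le_of_norm_le_const (a := 0) (b := 1) (C := B)
    (f := fun σ : ℝ => σ ^ j * f (σ ^ 2 * s)) (by
      intro σ hσ
      rw [uIoc_of_le zero_le_one] at hσ
      rw [Real.norm_eq_abs, abs_mul, abs_of_nonneg (pow_nonneg hσ.1.le j)]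
      calc σ ^ j * |f (σ ^ 2 * s)| ≤ 1 * |f (σ ^ 2 * s)| := by
            gcongr; exact pow_le_one₀ hσ.1.le hσ.2
        _ ≤ B := by rw [one_mul]; exact h σ hσ)
  simpa [kernelAvg] using this

lemma kernelAvg_sub (j : ℕ) {f g : ℝ → ℝ} (hf : Continuous f) (hg : Continuous g) (s : ℝ) :
    kernelAvg j f s - kernelAvg j g s = kernelAvg j (fun t => f t - g t) s := by
  unfold kernelAvg
  rw [← intervalIntegral.integral_sub
    (Continuous.intervalIntegrable (by fun_prop) _ _)
    (Continuous.intervalIntegrable (by fun_prop) _ _)]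
  simp only [mul_sub]

lemma abs_integral_le_exp_of_nonneg {f : ℝ → ℝ} {D Λ : ℝ} (hΛ : 0 < Λ)
    (hD : 0 ≤ D) (h : ∀ t, |f t| ≤ D * exp (Λ * |t|)) {s : ℝ} (hs : 0 ≤ s) :
    |∫ t in (0 : ℝ)..s, f t| ≤ D / Λ * exp (Λ * s) := by
  have h1 : ‖∫ t in (0 : ℝ)..s, f t‖ ≤ ∫ t in (0 : ℝ)..s, D * exp (Λ * t) := by
    apply intervalIntegral.norm_integral_le_of_norm_le hs
    · filter_upwards with t ht
      have := h t
      rwa [abs_of_pos ht.1] at this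
    · exact Continuous.intervalIntegrable (by fun_prop) _ _
  have h2 : ∫ t in (0 : ℝ)..s, D * exp (Λ * t) = D / Λ * exp (Λ * s) - D / Λ := by
    rw [intervalIntegral.integral_eq_sub_of_hasDerivAt (f := fun t => D / Λ * exp (Λ * t))]
    · simp
    · intro t _
      have := (((hasDerivAt_id' t).const_mul Λ).exp).const_mul (D / Λ)
      refine this.congr_deriv ?_
      field_simp
    · exact Continuous.intervalIntegrable (by fun_prop) _ _
  rw [h2] at h1
  have : 0 ≤ D / Λ := by positivity
  rw [Real.norm_eq_abs] at h1
  linarith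

lemma abs_integral_le_exp {f : ℝ → ℝ} {D Λ : ℝ} (hΛ : 0 < Λ)
    (hD : 0 ≤ D) (h : ∀ t, |f t| ≤ D * exp (Λ * |t|)) (s : ℝ) :
    |∫ t in (0 : ℝ)..s, f t| ≤ D / Λ * exp (Λ * |s|) := by
  rcases le_total 0 s with hs | hs
  · rw [abs_of_nonneg hs]
    exact abs_integral_le_exp_of_nonneg hΛ hD h hs
  · have h1 := abs_integral_le_exp_of_nonneg (f := fun t => f (-t)) hΛ hD
      (fun t => by simpa using h (-t)) (s := -s) (by linarith)
    rw [intervalIntegral.integral_comp_neg] at h1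
    simp only [neg_neg, neg_zero] at h1
    rw [intervalIntegral.integral_symm, abs_neg, abs_of_nonpos hs]
    exact h1

/-- Global solvability of the delay equation
`φ' = a F(φ) + b ∫₀¹ σ ^ j F(φ(σ² s)) dσ` for a bounded Lipschitz nonlinearity. -/
theorem exists_delay_solution {F : ℝ → ℝ} {L C : ℝ} (hL : 0 ≤ L)
    (hLip : ∀ x y, |F x - F y| ≤ L * |x - y|) (hC : ∀ x, |F x| ≤ C)
    (a b : ℝ) (j : ℕ) (φ₀ : ℝ) :
    ∃ φ : ℝ → ℝ, φ 0 = φ₀ ∧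
      ∀ s, HasDerivAt φ (a * F (φ s) + b * kernelAvg j (fun t => F (φ t)) s) s := by
  have hF : Continuous F := by
    have : LipschitzWith ⟨L, hL⟩ F := LipschitzWith.of_dist_le_mul (fun x y => hLip x y)
    exact this.continuous
  have hC0 : 0 ≤ C := (abs_nonneg _).trans (hC 0)
  set D : ℝ := |a| + |b| with hDdef
  have hD : 0 ≤ D := by positivity
  set Λ : ℝ := 2 * (D * L) + 1 with hΛdef
  have hΛ : 0 < Λ := by positivity
  let Φ : (ℝ →ᵇ ℝ) → ℝ → ℝ := fun g s => φ₀ + exp (Λ * |s|) * g s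
  have hΦ : ∀ g, Continuous (Φ g) := fun g => by
    have := g.continuous
    fun_prop
  let G : (ℝ →ᵇ ℝ) → ℝ → ℝ := fun g t => a * F (Φ g t) + b * kernelAvg j (fun t => F (Φ g t)) t
  have hG : ∀ g, Continuous (G g) := fun g => by
    have h1 := hΦ g
    have h2 : Continuous (kernelAvg j (fun t => F (Φ g t))) :=
      continuous_kernelAvg j (hF.comp h1)
    have h3 : Continuous fun t => F (Φ g t) := hF.comp h1
    fun_prop
  have hGb : ∀ g t, |G g t| ≤ D * C := fun g t => by
    calc |G g t| ≤ |a| * |F (Φ g t)| + |b| * |kernelAvg j (fun t => F (Φ g t)) t| := by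
          rw [← abs_mul, ← abs_mul]; exact abs_add_le _ _
      _ ≤ |a| * C + |b| * C := by
          gcongr
          · exact hC _
          · exact abs_kernelAvg_le j fun σ _ => hC _
      _ = D * C := by rw [hDdef]; ring
  have hGl : ∀ g₁ g₂ t, |G g₁ t - G g₂ t| ≤ D * L * dist g₁ g₂ * exp (Λ * |t|) := by
    intro g₁ g₂ t
    have key : ∀ r, |r| ≤ |t| →
        |F (Φ g₁ r) - F (Φ g₂ r)| ≤ L * dist g₁ g₂ * exp (Λ * |t|) := fun r hr => by
      calc |F (Φ g₁ r) - F (Φ g₂ r)| ≤ L * |Φ g₁ r - Φ g₂ r| := hLip _ _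
        _ = L * (exp (Λ * |r|) * |g₁ r - g₂ r|) := by
            have : Φ g₁ r - Φ g₂ r = exp (Λ * |r|) * (g₁ r - g₂ r) := by
              simp only [Φ]; ring
            rw [this, abs_mul, abs_of_pos (exp_pos _)]
        _ ≤ L * (exp (Λ * |t|) * dist g₁ g₂) := by
            gcongr
            exact BoundedContinuousFunction.dist_coe_le_dist (f := g₁) (g := g₂) r
        _ = _ := by ring
    have e : G g₁ t - G g₂ t = a * (F (Φ g₁ t) - F (Φ g₂ t)) +
        b * kernelAvg j (fun t => F (Φ g₁ t) - F (Φ g₂ t)) t := by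
      have := kernelAvg_sub j (hF.comp (hΦ g₁)) (hF.comp (hΦ g₂)) t
      simp only [Function.comp_def] at this
      rw [← this]
      ring
    rw [e]
    calc _ ≤ |a| * |F (Φ g₁ t) - F (Φ g₂ t)| +
          |b| * |kernelAvg j (fun t => F (Φ g₁ t) - F (Φ g₂ t)) t| := by
          rw [← abs_mul, ← abs_mul]; exact abs_add_le _ _
      _ ≤ |a| * (L * dist g₁ g₂ * exp (Λ * |t|)) + |b| * (L * dist g₁ g₂ * exp (Λ * |t|)) := by
          gcongr
          · exact key t le_rfl
          · refine abs_kernelAvg_le j fun σ hσ => key _ ?_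
            rw [abs_mul, abs_of_nonneg (sq_nonneg σ)]
            exact mul_le_of_le_one_left (abs_nonneg _) (pow_le_one₀ hσ.1.le hσ.2)
      _ = _ := by rw [hDdef]; ring
  have hweight : ∀ {f : ℝ → ℝ} {E : ℝ}, 0 ≤ E →
      (∀ t, |f t| ≤ E * exp (Λ * |t|)) → ∀ s,
      |exp (-(Λ * |s|)) * ∫ t in (0 : ℝ)..s, f t| ≤ E / Λ := by
    intro f E hE h s
    rw [abs_mul, abs_of_pos (exp_pos _)]
    calc _ ≤ exp (-(Λ * |s|)) * (E / Λ * exp (Λ * |s|)) := by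
          gcongr; exact abs_integral_le_exp hΛ hE h s
      _ = E / Λ * (exp (-(Λ * |s|)) * exp (Λ * |s|)) := by ring
      _ = E / Λ := by rw [← exp_add]; simp
  let T : (ℝ →ᵇ ℝ) → (ℝ →ᵇ ℝ) := fun g =>
    BoundedContinuousFunction.ofNormedAddCommGroup
      (fun s => exp (-(Λ * |s|)) * ∫ t in (0 : ℝ)..s, G g t)
      (by
        have := intervalIntegral.continuous_primitive
          (fun x y => (hG g).intervalIntegrable x y (μ := volume)) 0
        fun_prop)
      (D * C / Λ)
      (fun s => by
        refine hweight (by positivity) (fun t => ?_) s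
        refine (hGb g t).trans ?_
        exact le_mul_of_one_le_right (by positivity) (one_le_exp (by positivity)))
  have hT : ContractingWith (1 / 2 : ℝ≥0) T := by
    refine ⟨by norm_num, LipschitzWith.of_dist_le_mul fun g₁ g₂ => ?_⟩
    rw [BoundedContinuousFunction.dist_le (by positivity)]
    intro s
    have e : T g₁ s - T g₂ s =
        exp (-(Λ * |s|)) * ∫ t in (0 : ℝ)..s, (G g₁ t - G g₂ t) := by
      rw [intervalIntegral.integral_sub ((hG g₁).intervalIntegrable _ _)
        ((hG g₂).intervalIntegrable _ _), mul_sub]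
      rfl
    rw [Real.dist_eq, e]
    refine (hweight (by positivity) (hGl g₁ g₂) s).trans ?_
    rw [div_le_iff₀ hΛ, hΛdef]
    push_cast
    nlinarith [dist_nonneg (x := g₁) (y := g₂)]
  obtain ⟨g, hg⟩ : ∃ g, T g = g := ⟨_, hT.fixedPoint_isFixedPt⟩
  have hφ : Φ g = fun s => φ₀ + ∫ t in (0 : ℝ)..s, G g t := by
    funext s
    have h1 : g s = exp (-(Λ * |s|)) * ∫ t in (0 : ℝ)..s, G g t := by
      conv_lhs => rw [← hg]
      rfl
    simp only [Φ]
    rw [h1, ← mul_assoc, ← exp_add]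
    simp
  refine ⟨Φ g, by rw [hφ]; simp, fun s => ?_⟩
  have := ((hG g).integral_hasStrictDerivAt 0 s).hasDerivAt.const_add φ₀
  rw [← hφ] at this
  exact this

lemma sq_mul_mem_Icc {α R σ x : ℝ} (hα : α ≤ 0) (hR : 0 ≤ R) (hσ : σ ∈ Icc (0 : ℝ) 1)
    (hx : x ∈ Icc α R) : σ ^ 2 * x ∈ Icc α R := by
  have h0 : 0 ≤ σ ^ 2 := sq_nonneg σ
  have h1 : σ ^ 2 ≤ 1 := pow_le_one₀ hσ.1 hσ.2
  constructor <;> nlinarith [hx.1, hx.2]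

lemma exists_Icc_mem_nhds {δ s : ℝ} (hδ : 0 < δ) (hs : s ∈ Ioi (-δ)) :
    ∃ α R : ℝ, α ≤ 0 ∧ 0 ≤ R ∧ Icc α R ⊆ Ioi (-δ) ∧ Icc α R ∈ 𝓝 s := by
  obtain ⟨α, h1, h2⟩ := exists_between (lt_min hs (show -δ < 0 by linarith))
  refine ⟨α, max s 0 + 1, (h2.trans_le (min_le_right _ _)).le,
    by linarith [le_max_right s 0], fun x hx => lt_of_lt_of_le h1 hx.1,
    Icc_mem_nhds (h2.trans_le (min_le_left _ _)) (by linarith [le_max_left s 0])⟩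

lemma continuousOn_kernelIntegrand (j : ℕ) {f : ℝ → ℝ} {α R x : ℝ} (hα : α ≤ 0) (hR : 0 ≤ R)
    (hf : ContinuousOn f (Icc α R)) (hx : x ∈ Icc α R) :
    ContinuousOn (fun σ : ℝ => σ ^ j * f (σ ^ 2 * x)) (Icc 0 1) := by
  refine ContinuousOn.mul (by fun_prop) (hf.comp (by fun_prop) ?_)
  exact fun σ hσ => sq_mul_mem_Icc hα hR hσ hx

lemma aestronglyMeasurable_kernelIntegrand (j : ℕ) {f : ℝ → ℝ} {α R x : ℝ} (hα : α ≤ 0)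
    (hR : 0 ≤ R) (hf : ContinuousOn f (Icc α R)) (hx : x ∈ Icc α R) :
    AEStronglyMeasurable (fun σ : ℝ => σ ^ j * f (σ ^ 2 * x))
      (volume.restrict (uIoc (0 : ℝ) 1)) := by
  rw [uIoc_of_le zero_le_one]
  exact ((continuousOn_kernelIntegrand j hα hR hf hx).mono Ioc_subset_Icc_self).aestronglyMeasurable
    measurableSet_Ioc

lemma intervalIntegrable_kernelIntegrand (j : ℕ) {f : ℝ → ℝ} {α R x : ℝ} (hα : α ≤ 0)
    (hR : 0 ≤ R) (hf : ContinuousOn f (Icc α R)) (hx : x ∈ Icc α R) :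
    IntervalIntegrable (fun σ : ℝ => σ ^ j * f (σ ^ 2 * x)) volume 0 1 := by
  apply ContinuousOn.intervalIntegrable
  rw [uIcc_of_le zero_le_one]
  exact continuousOn_kernelIntegrand j hα hR hf hx

lemma norm_kernelIntegrand_le (j : ℕ) {f : ℝ → ℝ} {α R x B σ : ℝ} (hα : α ≤ 0)
    (hR : 0 ≤ R) (hB : ∀ y ∈ Icc α R, ‖f y‖ ≤ B) (hx : x ∈ Icc α R)
    (hσ : σ ∈ uIoc (0 : ℝ) 1) : ‖σ ^ j * f (σ ^ 2 * x)‖ ≤ B := by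
  rw [uIoc_of_le zero_le_one] at hσ
  have h1 := hB _ (sq_mul_mem_Icc hα hR ⟨hσ.1.le, hσ.2⟩ hx)
  rw [norm_mul, Real.norm_of_nonneg (pow_nonneg hσ.1.le j)]
  exact (mul_le_of_le_one_left (norm_nonneg _) (pow_le_one₀ hσ.1.le hσ.2)).trans h1

lemma continuousOn_kernelAvg (j : ℕ) {f : ℝ → ℝ} {δ : ℝ} (hδ : 0 < δ)
    (hf : ContinuousOn f (Ioi (-δ))) : ContinuousOn (kernelAvg j f) (Ioi (-δ)) := by
  intro s hs
  obtain ⟨α, R, hα, hR, hsub, hnhds⟩ := exists_Icc_mem_nhds hδ hs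
  have hf' := hf.mono hsub
  obtain ⟨B, hB⟩ := isCompact_Icc.exists_bound_of_continuousOn hf'
  apply ContinuousAt.continuousWithinAt
  refine intervalIntegral.continuousAt_of_dominated_interval (bound := fun _ => B) ?_ ?_
    intervalIntegrable_const ?_
  · filter_upwards [hnhds] with x hx
    exact aestronglyMeasurable_kernelIntegrand j hα hR hf' hx
  · filter_upwards [hnhds] with x hx
    exact ae_of_all _ fun σ hσ => norm_kernelIntegrand_le j hα hR hB hx hσ
  · refine ae_of_all _ fun σ hσ => ?_
    rw [uIoc_of_le zero_le_one] at hσ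
    have hmem := hsub (sq_mul_mem_Icc hα hR ⟨hσ.1.le, hσ.2⟩ (mem_of_mem_nhds hnhds))
    have h1 : ContinuousAt f (σ ^ 2 * s) := hf.continuousAt (Ioi_mem_nhds hmem)
    have h2 : ContinuousAt (fun x => f (σ ^ 2 * x)) s :=
      ContinuousAt.comp (f := fun x => σ ^ 2 * x) h1 (by fun_prop)
    exact continuousAt_const.mul h2

lemma hasDerivAt_kernelAvg (j : ℕ) {f f' : ℝ → ℝ} {δ : ℝ} (hδ : 0 < δ)
    (hf : ∀ s ∈ Ioi (-δ), HasDerivAt f (f' s) s) (hf' : ContinuousOn f' (Ioi (-δ)))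
    {s : ℝ} (hs : s ∈ Ioi (-δ)) :
    HasDerivAt (kernelAvg j f) (kernelAvg (j + 2) f' s) s := by
  obtain ⟨α, R, hα, hR, hsub, hnhds⟩ := exists_Icc_mem_nhds hδ hs
  have hfc : ContinuousOn f (Icc α R) := fun x hx =>
    (hf x (hsub hx)).continuousAt.continuousWithinAt
  have hfc' := hf'.mono hsub
  obtain ⟨B, hB⟩ := isCompact_Icc.exists_bound_of_continuousOn hfc'
  have hs' := mem_of_mem_nhds hnhds
  refine (intervalIntegral.hasDerivAt_integral_of_dominated_loc_of_deriv_le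
    (F := fun x σ => σ ^ j * f (σ ^ 2 * x)) (F' := fun x σ => σ ^ (j + 2) * f' (σ ^ 2 * x))
    (bound := fun _ => B) hnhds ?_ ?_ ?_ ?_ intervalIntegrable_const ?_).2
  · filter_upwards [hnhds] with x hx
    exact aestronglyMeasurable_kernelIntegrand j hα hR hfc hx
  · exact intervalIntegrable_kernelIntegrand j hα hR hfc hs'
  · exact aestronglyMeasurable_kernelIntegrand (j + 2) hα hR hfc' hs'
  · exact ae_of_all _ fun σ hσ x hx => norm_kernelIntegrand_le (j + 2) hα hR hB hx hσ
  · refine ae_of_all _ fun σ hσ x hx => ?_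
    rw [uIoc_of_le zero_le_one] at hσ
    have hmem := hsub (sq_mul_mem_Icc hα hR ⟨hσ.1.le, hσ.2⟩ hx)
    have h1 : HasDerivAt (fun y : ℝ => σ ^ 2 * y) (σ ^ 2) x := by
      simpa using (hasDerivAt_id' x).const_mul (σ ^ 2)
    refine (((hf _ hmem).comp x h1).const_mul (σ ^ j)).congr_deriv ?_
    ring

lemma contDiffOn_kernelAvg {δ : ℝ} (hδ : 0 < δ) (k : ℕ) : ∀ (j : ℕ) {f : ℝ → ℝ},
    ContDiffOn ℝ k f (Ioi (-δ)) → ContDiffOn ℝ k (kernelAvg j f) (Ioi (-δ)) := by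
  induction k with
  | zero =>
    intro j f hf
    simp only [Nat.cast_zero, contDiffOn_zero] at hf ⊢
    exact continuousOn_kernelAvg j hδ hf
  | succ k ih =>
    intro j f hf
    have hd := contDiffOn_succ_iff_deriv_of_isOpen isOpen_Ioi |>.1
      (show ContDiffOn ℝ ((k : WithTop ℕ∞) + 1) f (Ioi (-δ)) by exact_mod_cast hf)
    have hder : ∀ s ∈ Ioi (-δ), HasDerivAt (kernelAvg j f) (kernelAvg (j + 2) (deriv f) s) s :=
      fun s hs => hasDerivAt_kernelAvg j hδ
        (fun x hx => (hd.1.differentiableAt (Ioi_mem_nhds hx)).hasDerivAt)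
        hd.2.2.continuousOn hs
    have : ContDiffOn ℝ ((k : WithTop ℕ∞) + 1) (kernelAvg j f) (Ioi (-δ)) := by
      refine (contDiffOn_succ_iff_deriv_of_isOpen isOpen_Ioi).2
        ⟨fun s hs => (hder s hs).differentiableAt.differentiableWithinAt, by simp, ?_⟩
      exact (ih (j + 2) hd.2.2).congr fun s hs => (hder s hs).deriv
    exact_mod_cast this

/-- Integration by parts for the averages `kernelAvg`. -/
lemma kernelAvg_deriv_eq (j : ℕ) {f f' : ℝ → ℝ} {δ : ℝ} (hδ : 0 < δ)
    (hf : ∀ s ∈ Ioi (-δ), HasDerivAt f (f' s) s) (hf' : ContinuousOn f' (Ioi (-δ)))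
    {s : ℝ} (hs : s ∈ Ioi (-δ)) :
    2 * s * kernelAvg (j + 2) f' s = f s - (j + 1) * kernelAvg j f s := by
  obtain ⟨α, R, hα, hR, hsub, hnhds⟩ := exists_Icc_mem_nhds hδ hs
  have hfc : ContinuousOn f (Icc α R) := fun x hx =>
    (hf x (hsub hx)).continuousAt.continuousWithinAt
  have hs' := mem_of_mem_nhds hnhds
  have i1 := intervalIntegrable_kernelIntegrand j hα hR hfc hs'
  have i2 := intervalIntegrable_kernelIntegrand (j + 2) hα hR (hf'.mono hsub) hs'
  have key := intervalIntegral.integral_eq_sub_of_hasDerivAt (a := 0) (b := 1)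
    (f := fun σ : ℝ => σ ^ (j + 1) * f (σ ^ 2 * s))
    (f' := fun σ : ℝ => (j + 1) * (σ ^ j * f (σ ^ 2 * s)) +
      2 * s * (σ ^ (j + 2) * f' (σ ^ 2 * s))) (fun σ hσ => by
        rw [uIcc_of_le zero_le_one] at hσ
        have h1 : HasDerivAt (fun σ : ℝ => σ ^ 2 * s) (2 * σ * s) σ := by
          simpa using (hasDerivAt_pow 2 σ).mul_const s
        have h2 := (hf _ (hsub (sq_mul_mem_Icc hα hR hσ hs'))).comp σ h1
        refine ((hasDerivAt_pow (j + 1) σ).mul h2).congr_deriv ?_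
        simp only [Function.comp_apply, Nat.add_sub_cancel]
        push_cast
        ring) ((i1.const_mul _).add (i2.const_mul _))
  rw [intervalIntegral.integral_add (i1.const_mul _) (i2.const_mul _),
    intervalIntegral.integral_const_mul, intervalIntegral.integral_const_mul] at key
  simp only [one_pow, one_mul, ne_eq, Nat.succ_ne_zero, not_false_eq_true, zero_pow, zero_mul,
    sub_zero] at key
  unfold kernelAvg
  linarith

lemma abs_rpow_sub_rpow_le {p M x y : ℝ} (hp : 1 ≤ p) (hx : x ∈ Icc 0 M)
    (hy : y ∈ Icc 0 M) : |x ^ p - y ^ p| ≤ p * M ^ (p - 1) * |x - y| := by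
  refine (convex_Icc 0 M).norm_image_sub_le_of_norm_hasDerivWithin_le (f := fun z => z ^ p)
    (f' := fun z => p * z ^ (p - 1)) (fun z _ =>
      (Real.hasDerivAt_rpow_const (Or.inr hp)).hasDerivWithinAt) (fun z hz => ?_) hy hx
  have : 0 ≤ z ^ (p - 1) := rpow_nonneg hz.1 _
  rw [Real.norm_of_nonneg (by positivity)]
  gcongr
  exacts [hz.1, hz.2]

/-- A bounded, globally Lipschitz function that agrees with `x ^ p` on `[0, M]`. -/
lemma exists_truncated_rpow {p M : ℝ} (hp : 1 ≤ p) (hM : 0 < M) :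
    ∃ (F : ℝ → ℝ) (L : ℝ), 0 ≤ L ∧ (∀ x y, |F x - F y| ≤ L * |x - y|) ∧
      (∀ x, 0 ≤ F x) ∧ (∀ x, F x ≤ M ^ p) ∧ ∀ x ∈ Icc 0 M, F x = x ^ p := by
  have hmem : ∀ x, max 0 (min x M) ∈ Icc 0 M := fun x =>
    ⟨le_max_left _ _, max_le hM.le (min_le_right _ _)⟩
  refine ⟨fun x => (max 0 (min x M)) ^ p, p * M ^ (p - 1), by positivity, fun x y => ?_,
    fun x => rpow_nonneg (hmem x).1 _, fun x => ?_, fun x hx => ?_⟩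
  · refine (abs_rpow_sub_rpow_le hp (hmem x) (hmem y)).trans ?_
    refine mul_le_mul_of_nonneg_left ?_ (by positivity)
    have h1 := abs_max_sub_max_le_max 0 (min x M) 0 (min y M)
    have h2 := abs_min_sub_min_le_max x M y M
    simp only [sub_self, abs_zero, abs_nonneg, sup_of_le_right, sup_of_le_left] at h1 h2
    exact h1.trans h2
  · exact rpow_le_rpow (hmem x).1 (hmem x).2 (by linarith)
  · simp only
    rw [min_eq_left hx.2, max_eq_right hx.1]

lemma kernelAvg_le (j : ℕ) {f : ℝ → ℝ} {s C : ℝ} (hf : Continuous f) (h : ∀ x, f x ≤ C) :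
    kernelAvg j f s ≤ C / (j + 1) := by
  have h1 : kernelAvg j f s ≤ ∫ σ in (0 : ℝ)..1, σ ^ j * C := by
    refine intervalIntegral.integral_mono_on zero_le_one
      (Continuous.intervalIntegrable (by fun_prop) _ _)
      (Continuous.intervalIntegrable (by fun_prop) _ _) fun σ hσ => ?_
    exact mul_le_mul_of_nonneg_left (h _) (pow_nonneg hσ.1 j)
  rw [intervalIntegral.integral_mul_const, integral_pow] at h1
  simpa [div_eq_inv_mul] using h1

lemma kernelAvg_nonneg (j : ℕ) {f : ℝ → ℝ} {s : ℝ} (h : ∀ x, 0 ≤ f x) :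
    0 ≤ kernelAvg j f s :=
  intervalIntegral.integral_nonneg zero_le_one fun _ hσ => mul_nonneg (pow_nonneg hσ.1 j) (h _)

lemma kernelAvg_zero (j : ℕ) (f : ℝ → ℝ) : kernelAvg j f 0 = f 0 / (j + 1) := by
  simp [kernelAvg, div_eq_inv_mul]

lemma kernelAvg_congr (j : ℕ) {f g : ℝ → ℝ} {δ s : ℝ} (hδ : 0 < δ)
    (h : ∀ x ∈ Ioi (-δ), f x = g x) (hs : s ∈ Ioi (-δ)) :
    kernelAvg j f s = kernelAvg j g s := by
  obtain ⟨α, R, hα, hR, hsub, hnhds⟩ := exists_Icc_mem_nhds hδ hs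
  refine intervalIntegral.integral_congr fun σ hσ => ?_
  rw [uIcc_of_le zero_le_one] at hσ
  rw [h _ (hsub (sq_mul_mem_Icc hα hR hσ (mem_of_mem_nhds hnhds)))]

/-- Existence, positivity and smoothness of the profile in the variable `s = |x|²`, started at a
positive value: it solves the integrated form of the radial equation. -/
theorem exists_integral_profile {k B p φ₀ : ℝ} {j : ℕ} (hk : 0 < k) (hB : 0 < B) (hp : 1 < p)
    (hj : (j : ℝ) + 1 = 4 * k + 2) (hφ₀ : 0 < φ₀) :
    ∃ (δ : ℝ) (φ : ℝ → ℝ), 0 < δ ∧ φ 0 = φ₀ ∧ (∀ s ∈ Ioi (-δ), 0 < φ s) ∧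
      ∀ s ∈ Ioi (-δ), HasDerivAt φ
        (2 * k * B * kernelAvg j (fun t => φ t ^ p) s - B * φ s ^ p) s := by
  set M : ℝ := φ₀ + 1 with hMdef
  have hM : 0 < M := by positivity
  obtain ⟨F, L, hL, hLip, hF0, hFM, hFp⟩ := exists_truncated_rpow hp.le hM
  obtain ⟨φ, h0, hφ⟩ := exists_delay_solution hL hLip
    (fun x => by rw [abs_of_nonneg (hF0 x)]; exact hFM x) (-B) (2 * k * B) j φ₀
  have hφc : Continuous φ := continuous_iff_continuousAt.2 fun s => (hφ s).continuousAt
  have hFc : Continuous F := by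
    have : LipschitzWith ⟨L, hL⟩ F := LipschitzWith.of_dist_le_mul (fun x y => hLip x y)
    exact this.continuous
  have hFz : F 0 = 0 := by
    rw [hFp 0 ⟨le_rfl, hM.le⟩, zero_rpow (by linarith)]
  have hav : ∀ s, 0 ≤ kernelAvg j (fun t => F (φ t)) s := fun s =>
    kernelAvg_nonneg j fun x => hF0 _
  have hpos : ∀ s, 0 ≤ s → 0 < φ s := fun s hs => by
    have := image_le_of_deriv_right_lt_deriv_boundary (a := 0) (b := s) (f := fun t => -φ t)
      (B := fun t => -(φ₀ * exp (-(B * L + 1) * t)))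
      (B' := fun t => (B * L + 1) * (φ₀ * exp (-(B * L + 1) * t)))
      (by fun_prop) (fun x _ => (hφ x).neg.hasDerivWithinAt) (by simp [h0])
      (fun x => by
        refine (((((hasDerivAt_id' x).const_mul (-(B * L + 1))).exp).const_mul
          φ₀).neg).congr_deriv ?_
        ring)
      (fun x _ hx => by
        have hx' : φ x = φ₀ * exp (-(B * L + 1) * x) := by simpa using hx
        have hxpos : 0 < φ x := by rw [hx']; positivity
        rw [← hx']
        have h1 : F (φ x) ≤ L * φ x := by
          have := hLip (φ x) 0
          rw [hFz, sub_zero, sub_zero, abs_of_pos hxpos, abs_of_nonneg (hF0 _)] at this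
          exact this
        have h2 := mul_nonneg (show 0 ≤ 2 * k * B by positivity) (hav x)
        nlinarith [mul_le_mul_of_nonneg_left h1 hB.le]) (right_mem_Icc.2 hs)
    have h3 : 0 < φ₀ * exp (-(B * L + 1) * s) := by positivity
    linarith
  have hle : ∀ s, 0 ≤ s → φ s ≤ M := fun s hs => by
    refine image_le_of_deriv_right_lt_deriv_boundary (a := 0) (b := s) (f := φ)
      (B := fun _ => M) (B' := fun _ => 0) (by fun_prop) (fun x _ => (hφ x).hasDerivWithinAt)
      (by linarith) (fun x => hasDerivAt_const _ _) (fun x _ hx => ?_) (right_mem_Icc.2 hs)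
    rw [hx, hFp M ⟨hM.le, le_rfl⟩]
    have h1 := kernelAvg_le j (s := x) (hFc.comp hφc) (fun x => hFM (φ x))
    rw [hj, le_div_iff₀ (by positivity)] at h1
    simp only [Function.comp_def] at h1
    have h2 : 0 < M ^ p := by positivity
    have h3 := hav x
    nlinarith [mul_le_mul_of_nonneg_left h1 hB.le, mul_pos hB h2, mul_pos (mul_pos hk hB) h2,
      mul_nonneg hB.le h3]
  obtain ⟨δ, hδ, hδ'⟩ : ∃ δ > 0, ∀ s, |s| < δ → φ s ∈ Ioo 0 M := by
    have : ∀ᶠ s in 𝓝 (0 : ℝ), φ s ∈ Ioo 0 M :=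
      hφc.continuousAt (Ioo_mem_nhds (by rw [h0]; exact hφ₀) (by rw [h0]; linarith))
    obtain ⟨δ, hδ, h⟩ := Metric.eventually_nhds_iff.1 this
    exact ⟨δ, hδ, fun s hs => h (by simpa using hs)⟩
  have hmem : ∀ s ∈ Ioi (-δ), φ s ∈ Ioc 0 M := fun s hs => by
    rcases le_or_gt 0 s with h | h
    · exact ⟨hpos s h, hle s h⟩
    · have := hδ' s (by rw [abs_of_neg h]; linarith [mem_Ioi.1 hs])
      exact ⟨this.1, this.2.le⟩
  have hFeq : ∀ s ∈ Ioi (-δ), F (φ s) = φ s ^ p := fun s hs =>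
    hFp _ ⟨(hmem s hs).1.le, (hmem s hs).2⟩
  refine ⟨δ, φ, hδ, h0, fun s hs => (hmem s hs).1, fun s hs => ?_⟩
  rw [← kernelAvg_congr j hδ hFeq hs, ← hFeq s hs]
  exact (hφ s).congr_deriv (by ring)

/-- The profile of the radial solution in the variable `s = |x|²`. -/
theorem exists_profile {k B p φ₀ : ℝ} {j : ℕ} (hk : 0 < k) (hB : 0 < B) (hp : 1 < p)
    (hj : (j : ℝ) + 1 = 4 * k + 2) (hφ₀ : 0 < φ₀) :
    ∃ (δ : ℝ) (φ : ℝ → ℝ), 0 < δ ∧ φ 0 = φ₀ ∧ (∀ s ∈ Ioi (-δ), 0 < φ s) ∧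
      ContDiffOn ℝ ∞ φ (Ioi (-δ)) ∧ deriv φ 0 < 0 ∧
      ∀ s ∈ Ioi (-δ), s * deriv (deriv φ) s = -(1 + 2 * k) * deriv φ s
        - (1 + k) * B * φ s ^ p - B * (s * (deriv φ s * p * φ s ^ (p - 1))) := by
  obtain ⟨δ, φ, hδ, h0, hpos, hφ⟩ := exists_integral_profile hk hB hp hj hφ₀
  have hsmooth : ∀ i : ℕ, ContDiffOn ℝ i φ (Ioi (-δ)) := by
    intro i
    induction i with
    | zero =>
      simp only [Nat.cast_zero, contDiffOn_zero]
      exact fun s hs => (hφ s hs).continuousAt.continuousWithinAt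
    | succ i ih =>
      have hU : ContDiffOn ℝ i (fun t => φ t ^ p) (Ioi (-δ)) :=
        ih.rpow_const_of_ne fun s hs => (hpos s hs).ne'
      have : ContDiffOn ℝ ((i : WithTop ℕ∞) + 1) φ (Ioi (-δ)) := by
        refine (contDiffOn_succ_iff_deriv_of_isOpen isOpen_Ioi).2
          ⟨fun s hs => (hφ s hs).differentiableAt.differentiableWithinAt, by simp, ?_⟩
        exact ((contDiffOn_const.mul (contDiffOn_kernelAvg hδ i j hU)).sub
          (contDiffOn_const.mul hU)).congr fun s hs => (hφ s hs).deriv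
      exact_mod_cast this
  have hsm : ContDiffOn ℝ ∞ φ (Ioi (-δ)) := contDiffOn_infty.2 hsmooth
  have hder : ∀ s ∈ Ioi (-δ), deriv φ s =
      2 * k * B * kernelAvg j (fun t => φ t ^ p) s - B * φ s ^ p := fun s hs => (hφ s hs).deriv
  have hφ' : ∀ s ∈ Ioi (-δ), HasDerivAt φ (deriv φ s) s := fun s hs =>
    (hφ s hs).differentiableAt.hasDerivAt
  have hU : ∀ s ∈ Ioi (-δ),
      HasDerivAt (fun t => φ t ^ p) (deriv φ s * p * φ s ^ (p - 1)) s := fun s hs =>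
    (hφ' s hs).rpow_const (Or.inl (hpos s hs).ne')
  have hdc : ContinuousOn (deriv φ) (Ioi (-δ)) :=
    (hsm.deriv_of_isOpen (m := ∞) isOpen_Ioi (by simp)).continuousOn
  have hUc : ContinuousOn (fun s => deriv φ s * p * φ s ^ (p - 1)) (Ioi (-δ)) :=
    (hdc.mul continuousOn_const).mul
      (hsm.continuousOn.rpow_const fun s hs => Or.inl (hpos s hs).ne')
  have h0mem : (0 : ℝ) ∈ Ioi (-δ) := by simpa using hδ
  refine ⟨δ, φ, hδ, h0, hpos, hsm, ?_, fun s hs => ?_⟩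
  · rw [hder 0 h0mem, kernelAvg_zero, hj]
    have h1 : 0 < φ 0 ^ p := rpow_pos_of_pos (hpos 0 h0mem) _
    have h2 : 2 * k * B * (φ 0 ^ p / (4 * k + 2)) - B * φ 0 ^ p =
        -(B * φ 0 ^ p * ((2 * k + 2) / (4 * k + 2))) := by field_simp; ring
    rw [h2, neg_lt_zero]
    positivity
  · have h1 := ((hasDerivAt_kernelAvg j hδ hU hUc hs).const_mul (2 * k * B)).sub
      ((hU s hs).const_mul B)
    have h2 : deriv (deriv φ) s = 2 * k * B *
        kernelAvg (j + 2) (fun s => deriv φ s * p * φ s ^ (p - 1)) s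
        - B * (deriv φ s * p * φ s ^ (p - 1)) := by
      rw [← h1.deriv]
      refine Filter.EventuallyEq.deriv_eq ?_
      filter_upwards [Ioi_mem_nhds hs] with x hx using hder x hx
    have h3 := kernelAvg_deriv_eq j hδ hU hUc hs
    rw [hj] at h3
    rw [h2]
    have h4 := hder s hs
    linear_combination (k * B) * h3 + (1 + 2 * k) * h4

lemma le_add_mul_log {f f' : ℝ → ℝ} {c : ℝ} (hf : ∀ s, 1 ≤ s → HasDerivAt f (f' s) s)
    (hb : ∀ s, 1 ≤ s → f' s ≤ c / s) {s : ℝ} (hs : 1 ≤ s) : f s ≤ f 1 + c * log s := by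
  have hd : ∀ x ∈ Icc 1 s, HasDerivAt (fun t => f 1 + c * log t) (c / x) x := fun x hx =>
    ((Real.hasDerivAt_log (by linarith [hx.1])).const_mul c).const_add _
  exact image_le_of_deriv_right_le_deriv_boundary (a := 1) (b := s)
    (fun x hx => (hf x hx.1).continuousAt.continuousWithinAt)
    (fun x hx => (hf x hx.1).hasDerivWithinAt) (by simp)
    (fun x hx => (hd x hx).continuousAt.continuousWithinAt)
    (fun x hx => (hd x (Ico_subset_Icc_self hx)).hasDerivWithinAt)
    (fun x hx => hb x hx.1) (right_mem_Icc.2 hs)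

/-- If `z` is comparable to `Y` and `s z' = a Y ^ (k / (k + 1))`, then `Y` grows like
`(log s) ^ (k + 1)`. -/
lemma log_growth {k a A B : ℝ} {z Y : ℝ → ℝ} (hk : 0 < k) (ha : 0 < a) (hA : 0 < A) (hB : 0 < B)
    (hY : ∀ s, 1 ≤ s → 0 < Y s)
    (hz : ∀ s, 1 ≤ s → HasDerivAt z (a * Y s ^ (k / (k + 1)) / s) s)
    (hBz : ∀ s, 1 ≤ s → B * Y s ≤ z s) (hzA : ∀ s, 1 ≤ s → z s ≤ A * Y s) :
    ∃ c C : ℝ, 0 < c ∧ 0 < C ∧ ∀ s, exp 1 ≤ s →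
      c * log s ^ (k + 1) ≤ Y s ∧ Y s ≤ C * log s ^ (k + 1) := by
  set q : ℝ := k / (k + 1) with hq
  have hq0 : 0 < q := by positivity
  have hzpos : ∀ s, 1 ≤ s → 0 < z s := fun s hs =>
    (mul_pos hB (hY s hs)).trans_le (hBz s hs)
  have hexp : 1 / (k + 1) - 1 = -q := by rw [hq]; field_simp; ring
  set w : ℝ → ℝ := fun s => z s ^ (1 / (k + 1)) with hw
  have hwd : ∀ s, 1 ≤ s → HasDerivAt w (a / (k + 1) * (Y s / z s) ^ q / s) s := fun s hs => by
    refine ((hz s hs).rpow_const (p := 1 / (k + 1)) (Or.inl (hzpos s hs).ne')).congr_deriv ?_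
    rw [hexp, rpow_neg (hzpos s hs).le, div_rpow (hY s hs).le (hzpos s hs).le]
    field_simp
  set c₁ : ℝ := a / (k + 1) * (1 / A) ^ q with hc₁
  set c₂ : ℝ := a / (k + 1) * (1 / B) ^ q with hc₂
  have hc₁pos : 0 < c₁ := by positivity
  have hc₂pos : 0 < c₂ := by positivity
  have hup : ∀ s, 1 ≤ s → w s ≤ w 1 + c₂ * log s := fun s hs =>
    le_add_mul_log hwd (fun x hx => by
      have h0 := hzpos x hx
      have h1 := hY x hx
      rw [hc₂]
      gcongr ?_ * ?_ ^ _ / _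
      rw [div_le_div_iff₀ h0 hB]
      linarith [hBz x hx]) hs
  have hlow : ∀ s, 1 ≤ s → w 1 + c₁ * log s ≤ w s := fun s hs => by
    have := le_add_mul_log (c := -c₁) (fun x hx => (hwd x hx).neg) (fun x hx => by
      have h0 := hzpos x hx
      have h1 := hY x hx
      rw [neg_div, neg_le_neg_iff, hc₁]
      gcongr ?_ * ?_ ^ _ / _
      rw [div_le_div_iff₀ hA h0]
      linarith [hzA x hx]) hs
    simp only [Pi.neg_apply] at this
    linarith
  have hw1 : 0 < w 1 := rpow_pos_of_pos (hzpos 1 le_rfl) _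
  have hwz : ∀ s, 1 ≤ s → w s ^ (k + 1) = z s := fun s hs => by
    rw [hw, ← rpow_mul (hzpos s hs).le, one_div_mul_cancel (by positivity), rpow_one]
  refine ⟨c₁ ^ (k + 1) / A, (w 1 + c₂) ^ (k + 1) / B, by positivity, by positivity,
    fun s hs => ?_⟩
  have hs1 : 1 ≤ s := le_trans (one_le_exp zero_le_one) hs
  have hl : 1 ≤ log s := (le_log_iff_exp_le (by linarith)).2 hs
  constructor
  · rw [div_mul_eq_mul_div, div_le_iff₀ hA, ← mul_rpow hc₁pos.le (by linarith)]
    calc (c₁ * log s) ^ (k + 1) ≤ w s ^ (k + 1) := by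
          gcongr
          linarith [hlow s hs1]
      _ ≤ Y s * A := by rw [hwz s hs1]; linarith [hzA s hs1]
  · rw [div_mul_eq_mul_div, le_div_iff₀ hB, ← mul_rpow (by positivity) (by linarith)]
    calc Y s * B ≤ w s ^ (k + 1) := by rw [hwz s hs1]; linarith [hBz s hs1]
      _ ≤ ((w 1 + c₂) * log s) ^ (k + 1) := by
          have : 0 ≤ w s := rpow_nonneg (hzpos s hs1).le _
          gcongr
          nlinarith [hup s hs1]

/-- A profile solving the radial equation in the variable `s` decays like
`(log s / s) ^ (k + 1)`. -/
theorem profile_asymptotics {k B p δ : ℝ} {φ : ℝ → ℝ} (hk : 0 < k) (hB : 0 < B)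
    (hp : p = (k + 1) / k) (hδ : 0 < δ) (hpos : ∀ s ∈ Ioi (-δ), 0 < φ s)
    (hsm : ContDiffOn ℝ ∞ φ (Ioi (-δ))) (hd0 : deriv φ 0 < 0)
    (hode : ∀ s ∈ Ioi (-δ), s * deriv (deriv φ) s = -(1 + 2 * k) * deriv φ s
        - (1 + k) * B * φ s ^ p - B * (s * (deriv φ s * p * φ s ^ (p - 1)))) :
    ∃ c C : ℝ, 0 < c ∧ 0 < C ∧ ∀ s, exp 1 ≤ s →
      c * (log s / s) ^ (k + 1) ≤ φ s ^ p ∧ φ s ^ p ≤ C * (log s / s) ^ (k + 1) := by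
  have hmem : ∀ s : ℝ, 0 ≤ s → s ∈ Ioi (-δ) := fun s hs => by
    simp only [mem_Ioi]; linarith
  have hp1 : 1 < p := by rw [hp, lt_div_iff₀ hk]; linarith
  have hpk : p * k = k + 1 := by rw [hp]; field_simp
  have hD1 : ∀ s, 0 ≤ s → HasDerivAt φ (deriv φ s) s := fun s hs =>
    ((hsm.differentiableOn (by simp)).differentiableAt (Ioi_mem_nhds (hmem s hs))).hasDerivAt
  have hD2 : ∀ s, 0 ≤ s → HasDerivAt (deriv φ) (deriv (deriv φ) s) s := fun s hs =>
    (((hsm.deriv_of_isOpen (m := ∞) isOpen_Ioi (by simp)).differentiableOn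
      (by simp)).differentiableAt (Ioi_mem_nhds (hmem s hs))).hasDerivAt
  have hφpos : ∀ s, 0 ≤ s → 0 < φ s := fun s hs => hpos s (hmem s hs)
  have hmulpow : ∀ s, 0 ≤ s → φ s * φ s ^ (p - 1) = φ s ^ p := fun s hs => by
    rw [rpow_sub_one (hφpos s hs).ne']
    field_simp [(hφpos s hs).ne']
  have hdec : ∀ s, 0 ≤ s → deriv φ s ≤ 0 := fun s hs => by
    refine image_le_of_deriv_right_lt_deriv_boundary (a := 0) (b := s) (B := fun _ => 0)
      (B' := fun _ => 0) (fun x hx => (hD2 x hx.1).continuousAt.continuousWithinAt)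
      (fun x hx => (hD2 x hx.1).hasDerivWithinAt) hd0.le (fun x => hasDerivAt_const _ _)
      (fun x hx h => ?_) (right_mem_Icc.2 hs)
    have hx0 : 0 < x := lt_of_le_of_ne hx.1 (by rintro rfl; exact hd0.ne h)
    have h1 := hode x (hmem x hx.1)
    have h2 : 0 < φ x ^ p := rpow_pos_of_pos (hφpos x hx.1) _
    rw [h] at h1
    have h3 : x * deriv (deriv φ) x < 0 := by
      rw [h1]
      have : 0 < (1 + k) * B * φ x ^ p := by positivity
      linarith
    exact (pos_iff_neg_of_mul_neg h3).1 hx0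
  have hinc : ∀ s, 0 ≤ s → 0 ≤ k * φ s + s * deriv φ s := fun s hs => by
    have hD : ∀ x, 0 ≤ x → HasDerivAt (fun x => -(k * φ x + x * deriv φ x))
        (-(k * deriv φ x + (1 * deriv φ x + x * deriv (deriv φ) x))) x := fun x hx =>
      (((hD1 x hx).const_mul k).add ((hasDerivAt_id' x).mul (hD2 x hx))).neg
    have := image_le_of_deriv_right_lt_deriv_boundary (a := 0) (b := s) (B := fun _ => 0)
      (B' := fun _ => 0) (fun x hx => (hD x hx.1).continuousAt.continuousWithinAt)
      (fun x hx => (hD x hx.1).hasDerivWithinAt)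
      (by have := mul_pos hk (hφpos 0 le_rfl); simp only [zero_mul, add_zero]; linarith)
      (fun x => hasDerivAt_const _ _)
      (fun x hx h => by
        have h1 := hode x (hmem x hx.1)
        have h2 := hφpos x hx.1
        have h3 := hmulpow x hx.1
        have h4 : x * deriv φ x = -(k * φ x) := by linarith
        have h5 : x * (deriv φ x * p * φ x ^ (p - 1)) = -((k + 1) * φ x ^ p) := by
          linear_combination (p * φ x ^ (p - 1)) * h4 - (k * p) * h3 - (φ x ^ p) * hpk
        rw [h1, h5]
        have h6 : deriv φ x < 0 := by
          have := mul_pos hk h2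
          by_contra! h7
          nlinarith [mul_nonneg hx.1 h7]
        nlinarith [mul_pos hk (neg_pos.2 h6)]) (right_mem_Icc.2 hs)
    linarith
  have hymono : ∀ s, 1 ≤ s → φ 1 ≤ s ^ k * φ s := fun s hs => by
    have hD : ∀ x, 1 ≤ x → HasDerivAt (fun x => -(x ^ k * φ x))
        (-(x ^ (k - 1) * (k * φ x + x * deriv φ x))) x := fun x hx => by
      have hx0 : 0 < x := by linarith
      refine (((Real.hasDerivAt_rpow_const (p := k) (Or.inl hx0.ne')).mul
        (hD1 x hx0.le)).neg).congr_deriv ?_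
      rw [rpow_sub_one hx0.ne']
      field_simp
    have := le_add_mul_log (c := 0) hD (fun x hx => by
      have := mul_nonneg (rpow_nonneg (show 0 ≤ x by linarith) (k - 1)) (hinc x (by linarith))
      rw [zero_div]
      linarith) hs
    simp only [one_rpow, one_mul, zero_mul, add_zero] at this
    linarith
  have hY : ∀ s : ℝ, 0 < s → s ^ (k + 1) * φ s ^ p = (s ^ k * φ s) ^ p := fun s hs => by
    rw [mul_rpow (by positivity) (hφpos s hs.le).le, ← rpow_mul hs.le, mul_comm k p, hpk]
  have hφ1 := hφpos 1 zero_le_one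
  obtain ⟨c, C, hc, hC, h⟩ := log_growth (a := k ^ 2) (A := B + k * φ 1 ^ (1 - p))
    (z := fun s => s ^ k * (k * φ s + s * deriv φ s + B * (s * φ s ^ p)))
    (Y := fun s => s ^ (k + 1) * φ s ^ p) hk (by positivity) (by positivity) hB
    (fun s hs => by
      have h0 : 0 < s := by linarith
      have := hφpos s h0.le
      positivity)
    (fun s hs => by
      have h0 : 0 < s := by linarith
      have h1 := hφpos s h0.le
      have hU := (hD1 s h0.le).rpow_const (p := p) (Or.inl h1.ne')
      have hd := (Real.hasDerivAt_rpow_const (p := k) (Or.inl h0.ne')).mul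
        ((((hD1 s h0.le).const_mul k).add ((hasDerivAt_id' s).mul (hD2 s h0.le))).add
          (((hasDerivAt_id' s).mul hU).const_mul B))
      refine hd.congr_deriv ?_
      have h2 := hode s (hmem s h0.le)
      have e : (s ^ (k + 1) * φ s ^ p) ^ (k / (k + 1)) = s ^ k * φ s := by
        rw [hY s h0, ← rpow_mul (by positivity), hp]
        rw [show (k + 1) / k * (k / (k + 1)) = 1 by field_simp, rpow_one]
      simp only [e, h2]
      rw [rpow_sub_one h0.ne']
      field_simp
      simp only [Pi.add_apply, Pi.mul_apply]
      ring)
    (fun s hs => by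
      have h0 : 0 < s := by linarith
      have h1 := mul_nonneg (rpow_nonneg h0.le k) (hinc s h0.le)
      rw [rpow_add_one h0.ne']
      linarith)
    (fun s hs => by
      have h0 : 0 < s := by linarith
      have hφs := hφpos s h0.le
      have h1 := mul_nonneg (mul_nonneg (rpow_nonneg h0.le k) h0.le)
        (neg_nonneg.2 (hdec s h0.le))
      have hy : 0 < s ^ k * φ s := by positivity
      have h2 : s ^ k * φ s ≤ φ 1 ^ (1 - p) * (s ^ (k + 1) * φ s ^ p) := by
        rw [hY s h0]
        have h3 : (s ^ k * φ s) ^ (1 - p) ≤ φ 1 ^ (1 - p) :=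
          rpow_le_rpow_of_nonpos hφ1 (hymono s hs) (by linarith)
        calc s ^ k * φ s = (s ^ k * φ s) ^ (1 - p) * (s ^ k * φ s) ^ p := by
              rw [← rpow_add hy]; simp
          _ ≤ _ := by gcongr
      have h4 := mul_le_mul_of_nonneg_left h2 hk.le
      have h5 : s ^ (k + 1) = s ^ k * s := rpow_add_one h0.ne' k
      rw [h5] at h4 ⊢
      linarith)
  refine ⟨c, C, hc, hC, fun s hs => ?_⟩
  have hs1 : 1 ≤ s := le_trans (one_le_exp zero_le_one) hs
  have h0 : 0 < s := by linarith
  have hsk : 0 < s ^ (k + 1) := by positivity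
  obtain ⟨h1, h2⟩ := h s hs
  rw [div_rpow (log_nonneg hs1) h0.le]
  constructor
  · rw [← mul_div_assoc, div_le_iff₀ hsk]
    linarith
  · rw [← mul_div_assoc, le_div_iff₀ hsk]
    linarith

section Radial

variable {n : ℕ} {f f' f'' : ℝ → ℝ}

lemma hasFDerivAt_comp_norm_sq {d : ℝ} {x : Euc n} (hf : HasDerivAt f d (‖x‖ ^ 2)) :
    HasFDerivAt (fun y : Euc n => f (‖y‖ ^ 2)) (d • ((2 : ℝ) • innerSL ℝ x)) x :=
  hf.comp_hasFDerivAt x (by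
    simpa [two_smul] using (hasStrictFDerivAt_norm_sq x).hasFDerivAt)

lemma fderiv_comp_norm_sq_apply {d : ℝ} {x : Euc n} (hf : HasDerivAt f d (‖x‖ ^ 2))
    (v : Euc n) : fderiv ℝ (fun y : Euc n => f (‖y‖ ^ 2)) x v = d * (2 * ⟪x, v⟫) := by
  rw [(hasFDerivAt_comp_norm_sq hf).fderiv]
  simp

lemma inner_gradient_comp_norm_sq {d : ℝ} {x : Euc n} (hf : HasDerivAt f d (‖x‖ ^ 2)) :
    ⟪x, gradient (fun y : Euc n => f (‖y‖ ^ 2)) x⟫ = 2 * (‖x‖ ^ 2 * d) := by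
  rw [inner_gradient_right, fderiv_comp_norm_sq_apply hf, real_inner_self_eq_norm_sq]
  simp only [conj_trivial]
  ring

lemma lap_comp_norm_sq (hf : ∀ s, 0 ≤ s → HasDerivAt f (f' s) s)
    (hf' : ∀ s, 0 ≤ s → HasDerivAt f' (f'' s) s) (x : Euc n) :
    lap (fun y : Euc n => f (‖y‖ ^ 2)) x =
      4 * (‖x‖ ^ 2 * f'' (‖x‖ ^ 2)) + 2 * n * f' (‖x‖ ^ 2) := by
  have hterm : ∀ i : Fin n, fderiv ℝ (fun y : Euc n =>
      fderiv ℝ (fun y : Euc n => f (‖y‖ ^ 2)) y (EuclideanSpace.single i 1)) x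
      (EuclideanSpace.single i 1) = 4 * f'' (‖x‖ ^ 2) * x i ^ 2 + 2 * f' (‖x‖ ^ 2) := by
    intro i
    have h1 : (fun y : Euc n =>
        fderiv ℝ (fun y : Euc n => f (‖y‖ ^ 2)) y (EuclideanSpace.single i 1)) =
        fun y => f' (‖y‖ ^ 2) * (2 * EuclideanSpace.proj (𝕜 := ℝ) i y) := by
      funext y
      rw [fderiv_comp_norm_sq_apply (hf _ (sq_nonneg _))]
      simp [EuclideanSpace.inner_single_right]
    have h2 := (hasFDerivAt_comp_norm_sq (x := x) (hf' _ (sq_nonneg _))).fun_mul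
      ((EuclideanSpace.proj (𝕜 := ℝ) i).hasFDerivAt (x := x) |>.const_mul 2)
    rw [h1, h2.fderiv]
    simp [EuclideanSpace.inner_single_right]
    ring
  unfold lap
  simp only [hterm]
  rw [Finset.sum_add_distrib, ← Finset.mul_sum, ← EuclideanSpace.real_norm_sq_eq]
  simp
  ring

end Radial

/-- existence of the logarithmic cigar steady Yamabe solitons. -/
theorem logarithmic_cigars_exist (n : ℕ) (hn : 3 ≤ n)
    (m β γ : ℝ)
    (hm : m = ((n : ℝ) - 2) / ((n : ℝ) + 2))
    (hβ : 0 < β)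
    (hγ : γ = 2 * β / (1 - m)) :
    ∀ lam : ℝ, 0 < lam →
      ∃ u : Euc n → ℝ, (∀ x, 0 < u x) ∧ ContDiff ℝ (⊤ : ℕ∞) u ∧ IsRadial u ∧
        u 0 = lam ∧ YamabePDE m β γ u ∧
        ∃ c C r₀ : ℝ, 0 < c ∧ c ≤ C ∧ 1 < r₀ ∧
          ∀ x : Euc n, r₀ ≤ ‖x‖ →
            c * (Real.log ‖x‖ / ‖x‖ ^ 2) ^ (1 / (1 - m)) ≤ u x ∧
            u x ≤ C * (Real.log ‖x‖ / ‖x‖ ^ 2) ^ (1 / (1 - m)) := by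
  intro lam hlam
  have hn' : (3 : ℝ) ≤ n := by exact_mod_cast hn
  obtain ⟨k, hk⟩ : ∃ k : ℝ, (n : ℝ) = 4 * k + 2 := ⟨((n : ℝ) - 2) / 4, by ring⟩
  have hk0 : 0 < k := by linarith
  have hmk : m = k / (k + 1) := by
    rw [hm, hk, div_eq_div_iff (by linarith) (by linarith)]; ring
  have hm0 : 0 < m := by rw [hmk]; positivity
  have hm1 : 1 / (1 - m) = k + 1 := by
    rw [hmk, one_sub_div (by positivity), one_div_div]; simp
  have hγ' : γ = 2 * β * (k + 1) := by rw [hγ, ← hm1]; ring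
  set p : ℝ := (k + 1) / k with hp
  have hpm : p * m = 1 := by rw [hp, hmk]; field_simp
  have hp1 : 1 < p := by rw [hp, lt_div_iff₀ hk0]; linarith
  set K : ℝ := ((n : ℝ) - 1) / m with hK
  have hK0 : 0 < K := div_pos (by linarith) hm0
  set B : ℝ := β / (2 * K) with hBdef
  have hB : 0 < B := by positivity
  have hKB : 2 * (K * B) = β := by rw [hBdef]; field_simp
  have hj : ((n - 1 : ℕ) : ℝ) + 1 = 4 * k + 2 := by
    rw [← hk, Nat.cast_sub (by omega)]; simp
  obtain ⟨δ, φ, hδ, h0, hpos, hsm, hd0, hode⟩ :=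
    exists_profile hk0 hB hp1 hj (rpow_pos_of_pos hlam m)
  have hmem : ∀ s : ℝ, 0 ≤ s → s ∈ Ioi (-δ) := fun s hs => by
    simp only [mem_Ioi]; linarith
  have hD1 : ∀ s, 0 ≤ s → HasDerivAt φ (deriv φ s) s := fun s hs =>
    ((hsm.differentiableOn (by simp)).differentiableAt (Ioi_mem_nhds (hmem s hs))).hasDerivAt
  have hD2 : ∀ s, 0 ≤ s → HasDerivAt (deriv φ) (deriv (deriv φ) s) s := fun s hs =>
    (((hsm.deriv_of_isOpen (m := ∞) isOpen_Ioi (by simp)).differentiableOn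
      (by simp)).differentiableAt (Ioi_mem_nhds (hmem s hs))).hasDerivAt
  have hx : ∀ x : Euc n, ‖x‖ ^ 2 ∈ Ioi (-δ) := fun x => hmem _ (sq_nonneg _)
  obtain ⟨c, C, hc, hC, hasymp⟩ := profile_asymptotics hk0 hB hp hδ hpos hsm hd0 hode
  refine ⟨fun x => φ (‖x‖ ^ 2) ^ p, fun x => rpow_pos_of_pos (hpos _ (hx x)) _, ?_, ?_, ?_, ?_,
    2 ^ (k + 1) * c, 2 ^ (k + 1) * max c C, exp 1, by positivity, ?_, ?_, ?_⟩
  · have h1 : ContDiff ℝ ∞ (fun x : Euc n => φ (‖x‖ ^ 2)) :=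
      hsm.comp_contDiff (contDiff_norm_sq ℝ) hx
    exact h1.rpow_const_of_ne fun x => (hpos _ (hx x)).ne'
  · intro x y hxy
    simp only [hxy]
  · simp only [norm_zero, ne_eq, OfNat.ofNat_ne_zero, not_false_eq_true, zero_pow, h0]
    rw [← rpow_mul hlam.le, mul_comm m p, hpm, rpow_one]
  · intro x
    have h1 : (fun y : Euc n => (φ (‖y‖ ^ 2) ^ p) ^ m) = fun y => φ (‖y‖ ^ 2) := by
      funext y
      rw [← rpow_mul (hpos _ (hx y)).le, hpm, rpow_one]
    have h2 := inner_gradient_comp_norm_sq (x := x)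
      ((hD1 _ (sq_nonneg ‖x‖)).rpow_const (p := p) (Or.inl (hpos _ (hx x)).ne'))
    rw [← hK, h1, lap_comp_norm_sq hD1 hD2, h2, hode _ (hx x), hγ', ← hKB, hk]
    ring
  · gcongr
    exact le_max_left _ _
  · exact one_lt_exp_iff.2 one_pos
  · intro x hxr
    have h1 : 1 ≤ ‖x‖ := le_trans (one_le_exp zero_le_one) hxr
    obtain ⟨h2, h3⟩ := hasymp (‖x‖ ^ 2) (by nlinarith)
    have hl : 0 ≤ Real.log ‖x‖ / ‖x‖ ^ 2 := div_nonneg (log_nonneg h1) (sq_nonneg _)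
    have h4 : (Real.log (‖x‖ ^ 2) / ‖x‖ ^ 2) ^ (k + 1) =
        2 ^ (k + 1) * (Real.log ‖x‖ / ‖x‖ ^ 2) ^ (k + 1) := by
      rw [Real.log_pow, ← mul_rpow (by norm_num) hl]
      push_cast
      rw [mul_div_assoc]
    rw [h4] at h2 h3
    rw [hm1]
    refine ⟨by linarith, h3.trans ?_⟩
    have h5 : 0 ≤ (2 : ℝ) ^ (k + 1) * (Real.log ‖x‖ / ‖x‖ ^ 2) ^ (k + 1) := by positivity
    nlinarith [mul_le_mul_of_nonneg_right (le_max_right c C) h5]
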